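/- arXiv:2512.02152 — 2 statements merged into one kernel-verified Lean document; each statement's English description precedes it below -/
import Mathlib

section
/- Let A be a nonempty finite set, P ⊆ A a nonempty subset, N = A \ P, with N nonempty, j ∈ P, and x : A → ℝ. Then −log (∑_{p∈P} exp (x p)) + log (∑_{n∈N} exp (x n)) ≤ −x j + log (∑_{a∈A} exp (x a)), and the inequality is strict whenever P has at least two elements. -/
/-- Per-anchor comparison between the context-based ConTeX loss and the NT-Xent loss:
the context-based loss is bounded by the NT-Xent loss, strictly so when there is more
than one context positive. -/
theorem per_anchor_contex_le_ntxent {α : Type*} [DecidableEq α]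
    (A P : Finset α) (hA : A.Nonempty) (hPA : P ⊆ A) (hP : P.Nonempty)
    (hN : (A \ P).Nonempty) (j : α) (hj : j ∈ P) (x : α → ℝ) :
    (-Real.log (∑ p ∈ P, Real.exp (x p))
        + Real.log (∑ n ∈ A \ P, Real.exp (x n))
      ≤ -x j + Real.log (∑ a ∈ A, Real.exp (x a)))
    ∧ (2 ≤ P.card →
      -Real.log (∑ p ∈ P, Real.exp (x p))
          + Real.log (∑ n ∈ A \ P, Real.exp (x n))
        < -x j + Real.log (∑ a ∈ A, Real.exp (x a))) := by
  have hpos : x j ≤ Real.log (∑ p ∈ P, Real.exp (x p)) := by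
    rw [Real.le_log_iff_exp_le (Finset.sum_pos (fun p _ => Real.exp_pos (x p)) hP)]
    exact Finset.single_le_sum (fun p _ => (Real.exp_pos (x p)).le) hj
  have hneg : Real.log (∑ n ∈ A \ P, Real.exp (x n)) < Real.log (∑ a ∈ A, Real.exp (x a)) := by
    refine Real.log_lt_log (Finset.sum_pos (fun n _ => Real.exp_pos (x n)) hN) ?_
    exact Finset.sum_lt_sum_of_subset Finset.sdiff_subset (hPA hj) (by simp [hj])
      (Real.exp_pos (x j)) (fun a _ _ => (Real.exp_pos (x a)).le)
  exact ⟨by linarith, fun _ => by linarith⟩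
end

section
/- Let I = Fin n index the augmented samples of a batch with labels y : I → Fin m, and let x : I → I → ℝ give pairwise (temperature-scaled) similarities. For each a ∈ I let P(a) = {b ∈ I : b ≠ a ∧ y b = y a} and N(a) = {b ∈ I : b ≠ a ∧ y b ≠ y a}, and assume P(a) and N(a) are nonempty for every a; let p : I → I select for each anchor a an element p(a) ∈ P(a) (its self-positive). Then (1/n) ∑_{a∈I} [ −log (∑_{b∈P(a)} exp (x a b)) + log (∑_{b∈N(a)} exp (x a b)) ] ≤ (1/n) ∑_{a∈I} [ −x a (p a) + log (∑_{b≠a} exp (x a b)) ], and the inequality is strict if P(a) has at least two elements for some anchor a. -/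
/-- Dropping terms from a log-sum-exp over a nonempty set strictly decreases it. -/
theorem log_sum_exp_lt_of_ssubset {ι : Type*} {s t : Finset ι} (hs : s.Nonempty) (hst : s ⊂ t)
    (f : ι → ℝ) :
    Real.log (∑ b ∈ s, Real.exp (f b)) < Real.log (∑ b ∈ t, Real.exp (f b)) := by
  obtain ⟨i, hit, his⟩ := Finset.exists_of_ssubset hst
  exact Real.log_lt_log (Finset.sum_pos (fun b _ => Real.exp_pos _) hs)
    (Finset.sum_lt_sum_of_subset hst.1 hit his (Real.exp_pos _) fun b _ _ => (Real.exp_pos _).le)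

/-- Each value is at most the log-sum-exp over any finite set containing its index. -/
theorem le_log_sum_exp {ι : Type*} {s : Finset ι} {i : ι} (hi : i ∈ s) (f : ι → ℝ) :
    f i ≤ Real.log (∑ b ∈ s, Real.exp (f b)) := by
  rw [Real.le_log_iff_exp_le (Finset.sum_pos (fun b _ => Real.exp_pos _) ⟨i, hi⟩)]
  exact Finset.single_le_sum (f := fun b => Real.exp (f b)) (fun b _ => (Real.exp_pos _).le) hi

/-- The batch-averaged context-based ConTeX loss is bounded by the batch-averaged
NT-Xent loss, strictly so if some anchor has at least two context positives. -/
theorem batch_contex_le_ntxent (n m : ℕ) (y : Fin n → Fin m)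
    (x : Fin n → Fin n → ℝ)
    (P N : Fin n → Finset (Fin n))
    (hPdef : ∀ a, P a = Finset.univ.filter fun b => b ≠ a ∧ y b = y a)
    (hNdef : ∀ a, N a = Finset.univ.filter fun b => b ≠ a ∧ y b ≠ y a)
    (hPne : ∀ a, (P a).Nonempty) (hNne : ∀ a, (N a).Nonempty)
    (p : Fin n → Fin n) (hp : ∀ a, p a ∈ P a) :
    ((1 / (n : ℝ)) * ∑ a, (-Real.log (∑ b ∈ P a, Real.exp (x a b))
          + Real.log (∑ b ∈ N a, Real.exp (x a b)))
      ≤ (1 / (n : ℝ)) * ∑ a, (-(x a (p a))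
          + Real.log (∑ b ∈ Finset.univ.erase a, Real.exp (x a b))))
    ∧ ((∃ a, 2 ≤ (P a).card) →
      (1 / (n : ℝ)) * ∑ a, (-Real.log (∑ b ∈ P a, Real.exp (x a b))
          + Real.log (∑ b ∈ N a, Real.exp (x a b)))
      < (1 / (n : ℝ)) * ∑ a, (-(x a (p a))
          + Real.log (∑ b ∈ Finset.univ.erase a, Real.exp (x a b)))) := by
  have key : ∀ a, -Real.log (∑ b ∈ P a, Real.exp (x a b))
      + Real.log (∑ b ∈ N a, Real.exp (x a b))
      < -(x a (p a)) + Real.log (∑ b ∈ Finset.univ.erase a, Real.exp (x a b)) := by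
    intro a
    have hpa := hp a
    simp only [hPdef, Finset.mem_filter, Finset.mem_univ, true_and] at hpa
    have hN : N a ⊂ Finset.univ.erase a := by
      refine (Finset.ssubset_iff_of_subset fun b hb => ?_).2 ⟨p a, ?_, ?_⟩
      · simp only [hNdef, Finset.mem_filter, Finset.mem_univ, true_and] at hb
        simp [hb.1]
      · simp [hpa.1]
      · simp [hNdef, hpa.2]
    exact add_lt_add_of_le_of_lt (neg_le_neg (le_log_sum_exp (hp a) (x a)))
      (log_sum_exp_lt_of_ssubset (hNne a) hN (x a))
  refine ⟨mul_le_mul_of_nonneg_left (Finset.sum_le_sum fun a _ => (key a).le) (by positivity), ?_⟩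
  rintro ⟨a, -⟩
  have hn : (0 : ℝ) < n := by exact_mod_cast a.pos
  exact mul_lt_mul_of_pos_left
    (Finset.sum_lt_sum_of_nonempty ⟨a, Finset.mem_univ a⟩ fun a _ => key a) (by positivity)
end
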